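/- arXiv:1508.02239 — 2 statements merged into one kernel-verified Lean document; each statement's English description precedes it below -/
import Mathlib

section
/- Let X be a separable Banach space, (Ω,Σ) a measurable space, P a stochastic kernel on (Ω,Σ), and β ∈ [0,1). Let u: X × X × Ω → ℝ be bounded, with u(·,·,ω) continuous on X × X for every ω and u(x,y,·) measurable for every (x,y), and let Γ: X × Ω ⇉ X be a measurable multifunction with nonempty compact values such that Γ(·,ω) is continuous for every ω and Γ(x,·) is measurable for every x. Then there exists a unique function v ∈ C_b(X×Ω) satisfying the Bellman equation v(x,ω) = min_{y ∈ Γ(x,ω)} { u(x,y,ω) + β ∫ v(y,ω') P(dω'|ω) } for every (x,ω) ∈ X × Ω, the minimum being attained. -/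
open MeasureTheory Filter Topology Metric Set Pointwise
open scoped NNReal ENNReal

noncomputable section

universe u v

namespace Paper

section Defs

variable {X : Type u} [NormedAddCommGroup X] [NormedSpace ℝ X]
variable {Ω : Type v} [MeasurableSpace Ω]

/-- The identity map from the (strong) dual to the dual endowed with the weak* topology. -/
def wstar : (X →L[ℝ] ℝ) → WeakDual ℝ X := fun φ => φ

/-- Support function `s(x,C)` of a set `C ⊆ X*`. -/
def supp (x : X) (C : Set (X →L[ℝ] ℝ)) : ℝ :=
  sSup ((fun φ : X →L[ℝ] ℝ => φ x) '' C)

/-- `f` is Gelfand integrable: all scalarizations are integrable and the scalar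
integrals are represented by a continuous linear functional. -/
def GelfandIntegrable (μ : Measure Ω) (f : Ω → X →L[ℝ] ℝ) : Prop :=
  (∀ x : X, Integrable (fun ω => f ω x) μ) ∧
    ∃ g : X →L[ℝ] ℝ, ∀ x : X, g x = ∫ ω, f ω x ∂μ

/-- The set `S¹_Γ` of Gelfand-integrable a.e. selectors of `Γ`. -/
def selectors (μ : Measure Ω) (Γ : Ω → Set (X →L[ℝ] ℝ)) : Set (Ω → X →L[ℝ] ℝ) :=
  { f | GelfandIntegrable μ f ∧ ∀ᵐ ω ∂μ, f ω ∈ Γ ω }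

/-- The Gelfand integral `I(Γ) = { ∫ f dμ : f ∈ S¹_Γ }` of a multifunction. -/
def gelfandIntegral (μ : Measure Ω) (Γ : Ω → Set (X →L[ℝ] ℝ)) : Set (X →L[ℝ] ℝ) :=
  { g | ∃ f ∈ selectors μ Γ, ∀ x : X, g x = ∫ ω, f ω x ∂μ }

/-- The set `S^{1,w*}_Γ` of Gelfand-integrable w*-almost selectors of `Γ`. -/
def almostSelectors (μ : Measure Ω) (Γ : Ω → Set (X →L[ℝ] ℝ)) : Set (Ω → X →L[ℝ] ℝ) :=
  { f | GelfandIntegrable μ f ∧ ∀ x : X, ∀ᵐ ω ∂μ, f ω x ≤ supp x (Γ ω) }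

/-- `Γ` is w*-scalarly measurable. -/
def WScalarlyMeasurable (Γ : Ω → Set (X →L[ℝ] ℝ)) : Prop :=
  ∀ x : X, Measurable fun ω => supp x (Γ ω)

/-- `Γ` is w*-scalarly integrable. -/
def WScalarlyIntegrable (μ : Measure Ω) (Γ : Ω → Set (X →L[ℝ] ℝ)) : Prop :=
  ∀ x : X, Integrable (fun ω => supp x (Γ ω)) μ

/-- `Γ` is integrably bounded. -/
def IntegrablyBounded (μ : Measure Ω) (Γ : Ω → Set (X →L[ℝ] ℝ)) : Prop :=
  ∃ ψ : Ω → ℝ, Integrable ψ μ ∧ ∀ ω : Ω, ∀ φ ∈ Γ ω, ‖φ‖ ≤ ψ ω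

/-- `C ⊆ X*` is weak*-closed. -/
def WStarClosed (C : Set (X →L[ℝ] ℝ)) : Prop := IsClosed (wstar '' C)

/-- `C ⊆ X*` is weak*-compact. -/
def WStarCompact (C : Set (X →L[ℝ] ℝ)) : Prop := IsCompact (wstar '' C)

/-- Weak*-closure of `C ⊆ X*`. -/
def wstarClosure (C : Set (X →L[ℝ] ℝ)) : Set (X →L[ℝ] ℝ) :=
  wstar ⁻¹' closure (wstar '' C)

/-- Weak*-closed convex hull of `C ⊆ X*`. -/
def wstarClosedConvexHull (C : Set (X →L[ℝ] ℝ)) : Set (X →L[ℝ] ℝ) :=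
  wstar ⁻¹' closure (convexHull ℝ (wstar '' C))

/-- `Y` is an Asplund space: every continuous convex real function on an open convex
set is Fréchet differentiable on a dense subset of that set. -/
def Asplund (Y : Type*) [NormedAddCommGroup Y] [NormedSpace ℝ Y] : Prop :=
  ∀ U : Set Y, IsOpen U → Convex ℝ U →
    ∀ f : Y → ℝ, ContinuousOn f U → ConvexOn ℝ U f →
      U ⊆ closure { y | y ∈ U ∧ ∃ f' : Y →L[ℝ] ℝ, HasFDerivWithinAt f f' U y }

/-- `μ` is a nonatomic measure. -/
def Nonatomic (μ : Measure Ω) : Prop :=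
  ∀ A : Set Ω, MeasurableSet A → 0 < μ A →
    ∃ B : Set Ω, MeasurableSet B ∧ B ⊆ A ∧ 0 < μ B ∧ μ B < μ A

/-- `μ` is a saturated measure: `L¹` of every positive-measure restriction is nonseparable. -/
def Saturated (μ : Measure Ω) : Prop :=
  ∀ E : Set Ω, MeasurableSet E → 0 < μ E →
    ¬ TopologicalSpace.SeparableSpace (Lp ℝ 1 (μ.restrict E))

/-- `dens(Y)`: smallest cardinality of a dense subset of the open unit ball of `Y`. -/
def densCard (Y : Type u) [NormedAddCommGroup Y] : Cardinal.{u} :=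
  sInf { c : Cardinal.{u} |
    ∃ D : Set Y, D ⊆ ball (0 : Y) 1 ∧ ball (0 : Y) 1 ⊆ closure D ∧ Cardinal.mk ↥D = c }

/-- `dens(Y) < κ(μ)`: every family of `μ`-null measurable sets of cardinality at most
`dens(Y)` has measurable union. -/
def DensLtAdditivity (Y : Type u) [NormedAddCommGroup Y] (μ : Measure Ω) : Prop :=
  ∀ 𝒞 : Set (Set Ω), (∀ A ∈ 𝒞, MeasurableSet A ∧ μ A = 0) →
    Cardinal.lift.{u} (Cardinal.mk ↥𝒞) ≤ Cardinal.lift.{v} (densCard Y) →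
    MeasurableSet (⋃₀ 𝒞)

/-- Clarke generalized directional derivative `ψ°(x̄;h)`. -/
def clarkeDD (ψ : X → ℝ) (xbar h : X) : ℝ :=
  limsup (fun p : X × ℝ => (ψ (p.1 + p.2 • h) - ψ p.1) / p.2) ((𝓝 xbar) ×ˢ (𝓝[>] (0 : ℝ)))

/-- Clarke generalized gradient `∂°ψ(x̄)`. -/
def clarkeSubdiff (ψ : X → ℝ) (xbar : X) : Set (X →L[ℝ] ℝ) :=
  { φ | ∀ h : X, φ h ≤ clarkeDD ψ xbar h }

/-- `ψ` is (Clarke) regular at `x̄`: the directional derivative exists and equals `ψ°`. -/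
def ClarkeRegularAt (ψ : X → ℝ) (xbar : X) : Prop :=
  ∀ h : X, Tendsto (fun θ : ℝ => (ψ (xbar + θ • h) - ψ xbar) / θ) (𝓝[>] (0 : ℝ))
    (𝓝 (clarkeDD ψ xbar h))

/-- Limiting (Mordukhovich) subdifferential `∂ψ(x̄)`. -/
def limitingSubdiff (ψ : X → ℝ) (xbar : X) : Set (X →L[ℝ] ℝ) :=
  { p | ∃ (xk : ℕ → X) (pk : ℕ → X →L[ℝ] ℝ),
      Tendsto xk atTop (𝓝 xbar) ∧
      (∀ z : X, Tendsto (fun k => pk k z) atTop (𝓝 (p z))) ∧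
      ∀ k : ℕ, 0 ≤ liminf
        (fun y => (ψ y - ψ (xk k) - pk k (y - xk k)) / ‖y - xk k‖) (𝓝[≠] (xk k)) }

/-- Clarke generalized normal cone `N°(z̄;C)`. -/
def clarkeNormalCone (C : Set X) (zbar : X) : Set (X →L[ℝ] ℝ) :=
  wstarClosure (⋃ α ∈ Ioi (0 : ℝ), α • clarkeSubdiff (fun z => infDist z C) zbar)

/-- Limiting normal cone `N(z̄;C)`. -/
def limitingNormalCone (C : Set X) (zbar : X) : Set (X →L[ℝ] ℝ) :=
  ⋃ α ∈ Ioi (0 : ℝ), α • limitingSubdiff (fun z => infDist z C) zbar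

/-- A multifunction is lower semicontinuous. -/
def LowerSC {Y : Type*} [TopologicalSpace Y] {Z : Type*} [TopologicalSpace Z]
    (F : Y → Set Z) : Prop :=
  ∀ U : Set Z, IsOpen U → IsOpen { y | (F y ∩ U).Nonempty }

/-- A multifunction is upper semicontinuous. -/
def UpperSC {Y : Type*} [TopologicalSpace Y] {Z : Type*} [TopologicalSpace Z]
    (F : Y → Set Z) : Prop :=
  ∀ U : Set Z, IsOpen U → IsOpen { y | F y ⊆ U }

/-- `P` is a stochastic kernel (transition probability). -/
def StochasticKernel (P : Ω → Measure Ω) : Prop :=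
  (∀ ω, IsProbabilityMeasure (P ω)) ∧
    ∀ A : Set Ω, MeasurableSet A → Measurable fun ω => P ω A

/-- `v` is a bounded Carathéodory solution of the Bellman equation, the minimum
over `Γ x ω` being attained. -/
def BellmanSolution (P : Ω → Measure Ω) (β : ℝ) (u : X → X → Ω → ℝ)
    (Γ : X → Ω → Set X) (v : X → Ω → ℝ) : Prop :=
  (∃ M : ℝ, ∀ x ω, |v x ω| ≤ M) ∧
  (∀ ω, Continuous fun x => v x ω) ∧
  (∀ x, Measurable fun ω => v x ω) ∧
  ∀ x ω,
    (∃ y ∈ Γ x ω, v x ω = u x y ω + β * ∫ ω', v y ω' ∂(P ω)) ∧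
    ∀ y ∈ Γ x ω, v x ω ≤ u x y ω + β * ∫ ω', v y ω' ∂(P ω)

/-- The policy multifunction `G(x,ω)` associated with a Bellman solution `v`. -/
def policyMap (P : Ω → Measure Ω) (β : ℝ) (u : X → X → Ω → ℝ)
    (Γ : X → Ω → Set X) (v : X → Ω → ℝ) (x : X) (ω : Ω) : Set X :=
  { y ∈ Γ x ω | v x ω = u x y ω + β * ∫ ω', v y ω' ∂(P ω) }

/-- Standing assumptions (H1), (H2) on the stochastic DP problem. -/
def DPStandingAssumptions [MeasurableSpace X] (P : Ω → Measure Ω) (β : ℝ)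
    (u : X → X → Ω → ℝ) (Γ : X → Ω → Set X) : Prop :=
  StochasticKernel P ∧ 0 ≤ β ∧ β < 1 ∧
  (∃ M : ℝ, ∀ x y ω, |u x y ω| ≤ M) ∧
  (∀ ω, Continuous fun p : X × X => u p.1 p.2 ω) ∧
  (∀ x y, Measurable fun ω => u x y ω) ∧
  (∀ x ω, (Γ x ω).Nonempty ∧ IsCompact (Γ x ω)) ∧
  (∀ U : Set X, IsOpen U → MeasurableSet { p : X × Ω | (Γ p.1 p.2 ∩ U).Nonempty }) ∧
  (∀ ω, LowerSC (fun x => Γ x ω) ∧ UpperSC (fun x => Γ x ω)) ∧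
  (∀ x, ∀ U : Set X, IsOpen U → MeasurableSet { ω | (Γ x ω ∩ U).Nonempty })

/-- `G` is locally lower viable around `x̄` (relative to `Γ`). -/
def LocLowerViable (G Γ : X → Ω → Set X) (xbar : X) : Prop :=
  ∀ ω, ∃ U ∈ 𝓝 xbar, ∀ x ∈ U, ∀ x' ∈ U, (G x ω ∩ Γ x' ω).Nonempty

/-- `G` is locally upper viable around `x̄` (relative to `Γ`). -/
def LocUpperViable (G Γ : X → Ω → Set X) (xbar : X) : Prop :=
  ∀ ω, ∃ U ∈ 𝓝 xbar, ∀ x ∈ U, ∀ x' ∈ U, G x ω ⊆ Γ x' ω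

end Defs

/-- Minima of two functions over the same set are as close as the functions themselves. -/
theorem abs_sub_le_of_isLeast_image {Y : Type*} {f g : Y → ℝ} {K : Set Y} {a b D : ℝ}
    (ha : IsLeast (f '' K) a) (hb : IsLeast (g '' K) b) (h : ∀ y ∈ K, |f y - g y| ≤ D) :
    |a - b| ≤ D := by
  obtain ⟨⟨y, hy, rfl⟩, hl⟩ := ha
  obtain ⟨⟨z, hz, rfl⟩, hl'⟩ := hb
  have h₁ := hl (mem_image_of_mem f hz)
  have h₂ := hl' (mem_image_of_mem g hy)
  have h₃ := abs_le.1 (h y hy)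
  have h₄ := abs_le.1 (h z hz)
  exact abs_le.2 ⟨by linarith, by linarith⟩

/-- Berge's maximum theorem: the minimum value of a jointly continuous function over a
continuous compact-valued multifunction is continuous. -/
theorem continuous_of_isLeast_image {Y Z : Type*} [TopologicalSpace Y] [TopologicalSpace Z]
    {F : Y → Z → ℝ} (hF : Continuous fun p : Y × Z => F p.1 p.2) {K : Y → Set Z}
    (hK : ∀ x, IsCompact (K x)) (hl : LowerSC K) (hu : UpperSC K) {m : Y → ℝ}
    (hm : ∀ x, IsLeast (F x '' K x) (m x)) : Continuous m := by
  refine continuous_iff_continuousAt.2 fun x => tendsto_order.2 ⟨fun c hc => ?_, fun c hc => ?_⟩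
  · have hsub : ({x} : Set Y) ×ˢ K x ⊆ {p : Y × Z | c < F p.1 p.2} := by
      rintro ⟨x', y⟩ ⟨rfl, hy⟩
      exact hc.trans_le ((hm _).2 (mem_image_of_mem _ hy))
    obtain ⟨U, V, hU, hV, hxU, hKV, hUV⟩ := generalized_tube_lemma isCompact_singleton (hK x)
      (isOpen_lt continuous_const hF) hsub
    filter_upwards [hU.mem_nhds (hxU rfl), (hu V hV).mem_nhds hKV] with x' hx' hKx'
    obtain ⟨y, hy, hye⟩ := (hm x').1
    rw [← hye]
    exact hUV (mk_mem_prod hx' (hKx' hy))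
  · obtain ⟨y, hy, hye⟩ := (hm x).1
    have hmem : {p : Y × Z | F p.1 p.2 < c} ∈ 𝓝 (x, y) :=
      (isOpen_lt hF continuous_const).mem_nhds (by simpa [hye] using hc)
    obtain ⟨U, V, hU, hxU, hV, hyV, hUV⟩ := mem_nhds_prod_iff'.1 hmem
    filter_upwards [hU.mem_nhds hxU, (hl V hV).mem_nhds ⟨y, hy, hyV⟩] with x' hx' hKx'
    obtain ⟨z, hz, hzV⟩ := hKx'
    exact ((hm x').2 (mem_image_of_mem _ hz)).trans_lt (hUV (mk_mem_prod hx' hzV))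

/-- The minimum value of a Carathéodory function over a measurable multifunction is measurable. -/
theorem measurable_of_isLeast_image {Y Ω : Type*} [TopologicalSpace Y]
    [SecondCountableTopology Y] [MeasurableSpace Ω] {F : Ω → Y → ℝ}
    (hc : ∀ ω, Continuous (F ω)) (hF : ∀ y, Measurable fun ω => F ω y) {K : Ω → Set Y}
    (hK : ∀ U : Set Y, IsOpen U → MeasurableSet {ω | (K ω ∩ U).Nonempty}) {m : Ω → ℝ}
    (hm : ∀ ω, IsLeast (F ω '' K ω) (m ω)) : Measurable m := by
  obtain ⟨D, hDc, hD⟩ := TopologicalSpace.exists_countable_dense Y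
  refine measurable_of_Iio fun c => ?_
  have key : m ⁻¹' Iio c = ⋃ U ∈ TopologicalSpace.countableBasis Y, ⋃ q : ℚ, ⋃ _ : (q : ℝ) < c,
      ({ω | (K ω ∩ U).Nonempty} ∩ ⋂ d ∈ D, ⋂ _ : d ∈ U, {ω | F ω d ≤ q}) := by
    ext ω
    simp only [mem_preimage, mem_Iio, mem_iUnion, mem_inter_iff, mem_iInter, mem_ofPred_eq,
      exists_prop]
    constructor
    · intro h
      obtain ⟨y, hy, hye⟩ := (hm ω).1
      obtain ⟨q, hq, hqc⟩ := exists_rat_btwn h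
      obtain ⟨U, hU, hyU, hUq⟩ :=
        (TopologicalSpace.isBasis_countableBasis Y).exists_subset_of_mem_open
        (show y ∈ {z | F ω z < q} from by simpa [hye] using hq)
        (isOpen_lt (hc ω) continuous_const)
      exact ⟨U, hU, q, hqc, ⟨y, hy, hyU⟩, fun d _ hd => (hUq hd).le⟩
    · rintro ⟨U, hU, q, hqc, ⟨y, hy, hyU⟩, hq⟩
      have hUo := TopologicalSpace.isOpen_of_mem_countableBasis hU
      have hsub : closure (U ∩ D) ⊆ {z | F ω z ≤ q} :=
        closure_minimal (fun d hd => hq d hd.2 hd.1) (isClosed_le (hc ω) continuous_const)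
      have hy' : F ω y ≤ q := hsub (hD.open_subset_closure_inter hUo hyU)
      exact (((hm ω).2 (mem_image_of_mem _ hy)).trans hy').trans_lt hqc
  rw [key]
  refine MeasurableSet.biUnion (TopologicalSpace.countable_countableBasis Y) fun U hU =>
    MeasurableSet.iUnion fun q => MeasurableSet.iUnion fun _ =>
      (hK U (TopologicalSpace.isOpen_of_mem_countableBasis hU)).inter <|
        MeasurableSet.biInter hDc fun d _ => MeasurableSet.iInter fun _ =>
          measurableSet_le (hF d) measurable_const

/-- Membership in `C_b(X × Ω)`: bounded, continuous in `x` and measurable in `ω`. -/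
structure IsBoundedCaratheodory {X : Type u} [TopologicalSpace X] {Ω : Type v}
    [MeasurableSpace Ω] (v : X → Ω → ℝ) : Prop where
  bounded : ∃ M : ℝ, ∀ x ω, |v x ω| ≤ M
  continuous : ∀ ω, Continuous fun x => v x ω
  measurable : ∀ x, Measurable fun ω => v x ω

namespace IsBoundedCaratheodory

variable {X : Type u} [TopologicalSpace X] {Ω : Type v} [MeasurableSpace Ω] {v w : X → Ω → ℝ}

theorem integrable (hv : IsBoundedCaratheodory v) (μ : Measure Ω) [IsFiniteMeasure μ] (x : X) :
    Integrable (v x) μ := by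
  obtain ⟨M, hM⟩ := hv.bounded
  exact Integrable.of_bound (hv.measurable x).aestronglyMeasurable M (ae_of_all _ (hM x))

theorem continuous_integral [FirstCountableTopology X] (hv : IsBoundedCaratheodory v)
    (μ : Measure Ω) [IsFiniteMeasure μ] : Continuous fun x => ∫ ω, v x ω ∂μ := by
  obtain ⟨M, hM⟩ := hv.bounded
  exact continuous_of_dominated (fun x => (hv.measurable x).aestronglyMeasurable)
    (fun x => ae_of_all _ (hM x)) (integrable_const M) (ae_of_all _ hv.continuous)

theorem measurable_integral (hv : IsBoundedCaratheodory v) {P : Ω → Measure Ω}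
    (hP : StochasticKernel P) (x : X) : Measurable fun ω => ∫ ω', v x ω' ∂(P ω) := by
  let κ : ProbabilityTheory.Kernel Ω Ω := ⟨P, Measure.measurable_of_measurable_coe P hP.2⟩
  exact ((hv.measurable x).stronglyMeasurable.integral_kernel (κ := κ)).measurable

theorem abs_integral_sub_le (hv : IsBoundedCaratheodory v) (hw : IsBoundedCaratheodory w)
    (μ : Measure Ω) [IsProbabilityMeasure μ] {D : ℝ} (h : ∀ x ω, |v x ω - w x ω| ≤ D) (x : X) :
    |∫ ω, v x ω ∂μ - ∫ ω, w x ω ∂μ| ≤ D := by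
  rw [← integral_sub (hv.integrable μ x) (hw.integrable μ x)]
  simpa using norm_integral_le_of_norm_le_const (f := fun ω => v x ω - w x ω) (μ := μ)
    (ae_of_all _ (h x))

theorem of_tendsto {s : ℕ → X → Ω → ℝ} (hs : ∀ n, IsBoundedCaratheodory (s n)) {b : ℕ → ℝ}
    (hb : Tendsto b atTop (𝓝 0)) (h : ∀ n x ω, |s n x ω - v x ω| ≤ b n) :
    IsBoundedCaratheodory v where
  bounded := by
    obtain ⟨M, hM⟩ := (hs 0).bounded
    refine ⟨M + b 0, fun x ω => ?_⟩
    have h₁ := abs_le.1 (hM x ω)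
    have h₂ := abs_le.1 (h 0 x ω)
    exact abs_le.2 ⟨by linarith, by linarith⟩
  continuous ω := by
    have hu : TendstoUniformly (fun n x => s n x ω) (fun x => v x ω) atTop := by
      refine Metric.tendstoUniformly_iff.2 fun ε hε => ?_
      filter_upwards [hb.eventually_lt_const hε] with n hn x
      rw [dist_comm]
      exact (h n x ω).trans_lt hn
    exact hu.continuous (Frequently.of_forall fun n => (hs n).continuous ω)
  measurable x := by
    refine measurable_of_tendsto_metrizable (fun n => (hs n).measurable x)
      (tendsto_pi_nhds.2 fun ω => ?_)
    exact tendsto_iff_dist_tendsto_zero.2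
      (squeeze_zero (fun _ => dist_nonneg) (fun n => h n x ω) hb)

end IsBoundedCaratheodory

/-- The objective minimized on the right-hand side of the Bellman equation. -/
def bellmanObjective {X : Type u} {Ω : Type v} [MeasurableSpace Ω] (P : Ω → Measure Ω) (β : ℝ)
    (u : X → X → Ω → ℝ) (v : X → Ω → ℝ) (x : X) (ω : Ω) (y : X) : ℝ :=
  u x y ω + β * ∫ ω', v y ω' ∂(P ω)

section Bellman

variable {X : Type u} [NormedAddCommGroup X] {Ω : Type v} [MeasurableSpace Ω]
  {P : Ω → Measure Ω} {β : ℝ} {u : X → X → Ω → ℝ} {Γ : X → Ω → Set X} {v w : X → Ω → ℝ}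

theorem bellmanSolution_iff [NormedSpace ℝ X] : BellmanSolution P β u Γ v ↔
    IsBoundedCaratheodory v ∧
      ∀ x ω, IsLeast (bellmanObjective P β u v x ω '' Γ x ω) (v x ω) := by
  have key : ∀ x ω, IsLeast (bellmanObjective P β u v x ω '' Γ x ω) (v x ω) ↔
      (∃ y ∈ Γ x ω, v x ω = u x y ω + β * ∫ ω', v y ω' ∂(P ω)) ∧
        ∀ y ∈ Γ x ω, v x ω ≤ u x y ω + β * ∫ ω', v y ω' ∂(P ω) := fun x ω => by
    simp only [IsLeast, mem_lowerBounds, mem_image, forall_exists_index, and_imp,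
      forall_apply_eq_imp_iff₂, bellmanObjective, eq_comm (a := v x ω)]
  simp only [key]
  exact ⟨fun ⟨h₁, h₂, h₃, h₄⟩ => ⟨⟨h₁, h₂, h₃⟩, h₄⟩, fun ⟨⟨h₁, h₂, h₃⟩, h₄⟩ => ⟨h₁, h₂, h₃, h₄⟩⟩

/-- The Bellman operator is a `β`-contraction. -/
theorem abs_sub_le_of_isLeast_bellmanObjective (hP : StochasticKernel P) (hβ : 0 ≤ β)
    (hv : IsBoundedCaratheodory v) (hw : IsBoundedCaratheodory w) {D : ℝ}
    (h : ∀ x ω, |v x ω - w x ω| ≤ D) {x : X} {ω : Ω} {a b : ℝ}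
    (ha : IsLeast (bellmanObjective P β u v x ω '' Γ x ω) a)
    (hb : IsLeast (bellmanObjective P β u w x ω '' Γ x ω) b) : |a - b| ≤ β * D := by
  have := hP.1 ω
  refine abs_sub_le_of_isLeast_image ha hb fun y _ => ?_
  rw [bellmanObjective, bellmanObjective, add_sub_add_left_eq_sub, ← mul_sub, abs_mul,
    abs_of_nonneg hβ]
  exact mul_le_mul_of_nonneg_left (hv.abs_integral_sub_le hw (P ω) h y) hβ

/-- The Bellman operator is well defined on bounded Carathéodory functions. -/
theorem exists_isLeast_bellmanObjective [NormedSpace ℝ X] [TopologicalSpace.SeparableSpace X]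
    [MeasurableSpace X] (hDP : DPStandingAssumptions P β u Γ) (hv : IsBoundedCaratheodory v) :
    ∃ w : X → Ω → ℝ, IsBoundedCaratheodory w ∧
      ∀ x ω, IsLeast (bellmanObjective P β u v x ω '' Γ x ω) (w x ω) := by
  obtain ⟨hP, hβ, -, ⟨M, hM⟩, huc, hum, hΓ, -, hΓc, hΓm⟩ := hDP
  have := UniformSpace.secondCountable_of_separable X
  have hcont : ∀ ω, Continuous fun p : X × X => bellmanObjective P β u v p.1 ω p.2 := fun ω => by
    have := hP.1 ω
    exact (huc ω).add (continuous_const.mul ((hv.continuous_integral (P ω)).comp continuous_snd))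
  have hcont' : ∀ x ω, Continuous (bellmanObjective P β u v x ω) := fun x ω =>
    (hcont ω).comp (Continuous.prodMk_right x)
  have hex : ∀ x ω, ∃ a, IsLeast (bellmanObjective P β u v x ω '' Γ x ω) a := fun x ω =>
    ((hΓ x ω).2.image (hcont' x ω)).exists_isLeast ((hΓ x ω).1.image _)
  choose w hw using hex
  refine ⟨w, ⟨?_, fun ω => ?_, fun x => ?_⟩, hw⟩
  · obtain ⟨N, hN⟩ := hv.bounded
    refine ⟨M + β * N, fun x ω => ?_⟩
    have := hP.1 ω
    obtain ⟨y, -, hy⟩ := (hw x ω).1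
    rw [← hy, bellmanObjective]
    refine (abs_add_le _ _).trans (add_le_add (hM x y ω) ?_)
    rw [abs_mul, abs_of_nonneg hβ]
    refine mul_le_mul_of_nonneg_left ?_ hβ
    simpa using norm_integral_le_of_norm_le_const (f := v y) (μ := P ω) (ae_of_all _ (hN y))
  · exact continuous_of_isLeast_image (hcont ω) (fun x => (hΓ x ω).2) (hΓc ω).1 (hΓc ω).2
      fun x => hw x ω
  · exact measurable_of_isLeast_image (hcont' x)
      (fun y => (hum x y).add (measurable_const.mul (hv.measurable_integral hP y))) (hΓm x) (hw x)

theorem BellmanSolution.unique [NormedSpace ℝ X] (hP : StochasticKernel P) (hβ : 0 ≤ β)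
    (hβ' : β < 1) (hv : BellmanSolution P β u Γ v) (hw : BellmanSolution P β u Γ w) : v = w := by
  obtain ⟨hv, hvl⟩ := bellmanSolution_iff.1 hv
  obtain ⟨hw, hwl⟩ := bellmanSolution_iff.1 hw
  obtain ⟨M, hM⟩ := hv.bounded
  obtain ⟨N, hN⟩ := hw.bounded
  have h : ∀ n : ℕ, ∀ x ω, |v x ω - w x ω| ≤ β ^ n * (M + N) := by
    intro n
    induction n with
    | zero =>
      intro x ω
      simpa using (abs_sub _ _).trans (add_le_add (hM x ω) (hN x ω))
    | succ n ih =>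
      intro x ω
      rw [pow_succ', mul_assoc]
      exact abs_sub_le_of_isLeast_bellmanObjective hP hβ hv hw ih (hvl x ω) (hwl x ω)
  funext x ω
  have hlim : Tendsto (fun n : ℕ => β ^ n * (M + N)) atTop (𝓝 0) := by
    simpa using (tendsto_pow_atTop_nhds_zero_of_lt_one hβ hβ').mul_const (M + N)
  exact sub_eq_zero.1 (abs_nonpos_iff.1 (ge_of_tendsto' hlim fun n => h n x ω))

theorem exists_bellmanSolution [NormedSpace ℝ X] [TopologicalSpace.SeparableSpace X]
    [MeasurableSpace X] (hDP : DPStandingAssumptions P β u Γ) :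
    ∃ v : X → Ω → ℝ, BellmanSolution P β u Γ v := by
  have hex : ∀ v : {v : X → Ω → ℝ // IsBoundedCaratheodory v},
      ∃ w : {v : X → Ω → ℝ // IsBoundedCaratheodory v},
        ∀ x ω, IsLeast (bellmanObjective P β u v.1 x ω '' Γ x ω) (w.1 x ω) := fun v =>
    let ⟨w, hw, hwl⟩ := exists_isLeast_bellmanObjective hDP v.2
    ⟨⟨w, hw⟩, hwl⟩
  choose T hT using hex
  obtain ⟨hP, hβ, hβ', -⟩ := hDP
  let s : ℕ → {v : X → Ω → ℝ // IsBoundedCaratheodory v} := fun n =>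
    T^[n] ⟨fun _ _ => 0, ⟨0, by simp⟩, fun _ => continuous_const, fun _ => measurable_const⟩
  have hs : ∀ n, s (n + 1) = T (s n) := fun n => Function.iterate_succ_apply' T n _
  obtain ⟨C, hC⟩ := (s 1).2.bounded
  have hstep : ∀ n x ω, |(s n).1 x ω - (s (n + 1)).1 x ω| ≤ C * β ^ n := by
    intro n
    induction n with
    | zero =>
      intro x ω
      simpa [s] using hC x ω
    | succ n ih =>
      intro x ω
      have h := abs_sub_le_of_isLeast_bellmanObjective hP hβ (s n).2 (s (n + 1)).2 ih
        (hT (s n) x ω) (hT (s (n + 1)) x ω)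
      rw [hs n, hs (n + 1)]
      calc _ ≤ β * (C * β ^ n) := h
        _ = C * β ^ (n + 1) := by ring
  have hlim : ∀ x ω, ∃ a, Tendsto (fun n => (s n).1 x ω) atTop (𝓝 a) := fun x ω =>
    cauchySeq_tendsto_of_complete
      (cauchySeq_of_le_geometric β C hβ' fun n => hstep n x ω)
  choose v hv using hlim
  have hdist : ∀ n x ω, |(s n).1 x ω - v x ω| ≤ C * β ^ n / (1 - β) := fun n x ω =>
    dist_le_of_le_geometric_of_tendsto β C hβ' (fun n => hstep n x ω) (hv x ω) n
  have hb : Tendsto (fun n : ℕ => C * β ^ n / (1 - β)) atTop (𝓝 0) := by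
    simpa using ((tendsto_pow_atTop_nhds_zero_of_lt_one hβ hβ').const_mul C).div_const (1 - β)
  have hvC : IsBoundedCaratheodory v := .of_tendsto (fun n => (s n).2) hb hdist
  refine ⟨v, bellmanSolution_iff.2 ⟨hvC, fun x ω => ?_⟩⟩
  have hTv : Tendsto (fun n => (s (n + 1)).1 x ω) atTop (𝓝 ((T ⟨v, hvC⟩).1 x ω)) := by
    refine tendsto_iff_dist_tendsto_zero.2 (squeeze_zero (fun _ => dist_nonneg) (fun n => ?_)
      (by simpa using hb.const_mul β))
    rw [hs n]
    exact abs_sub_le_of_isLeast_bellmanObjective hP hβ (s n).2 hvC (hdist n)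
      (hT (s n) x ω) (hT ⟨v, hvC⟩ x ω)
  rw [tendsto_nhds_unique ((tendsto_add_atTop_iff_nat 1).2 (hv x ω)) hTv]
  exact hT ⟨v, hvC⟩ x ω

end Bellman

/-- existence and uniqueness of a bounded Carathéodory solution of the
integral Bellman equation for the stochastic DP problem, with the minimum attained. -/
theorem bellman_equation_existence_uniqueness
    {X : Type u} [NormedAddCommGroup X] [NormedSpace ℝ X] [CompleteSpace X]
    [TopologicalSpace.SeparableSpace X] [MeasurableSpace X] [BorelSpace X]
    {Ω : Type v} [MeasurableSpace Ω]
    (P : Ω → Measure Ω) (β : ℝ) (u : X → X → Ω → ℝ) (Γ : X → Ω → Set X)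
    (hDP : DPStandingAssumptions P β u Γ) :
    ∃! v : X → Ω → ℝ, BellmanSolution P β u Γ v := by
  obtain ⟨v, hv⟩ := exists_bellmanSolution hDP
  exact ⟨v, hv, fun w hw => hw.unique hDP.1 hDP.2.1 hDP.2.2.1 hv⟩

end Paper
end
end

section
/- Let X be a separable Banach space, P a stochastic kernel on a measurable space (Ω,Σ), β ∈ [0,1), u and Γ as in the Bellman existence theorem, v ∈ C_b(X×Ω) the unique solution of the Bellman equation, and G the associated policy multifunction. Let x̄ ∈ X be such that G(x̄,ω) ≠ ∅ for every ω ∈ Ω. Assume that u(·,·,ω) is locally Lipschitzian around (x̄,y) with modulus ℓ(ω) for every y ∈ G(x,ω) with x near x̄ and every ω ∈ Ω, and that G is locally lower viable around x̄. Then for every ω ∈ Ω the value function v(·,ω) is locally Lipschitzian around x̄ (with modulus ℓ(ω)). -/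
open MeasureTheory Filter Topology Metric Set Pointwise
open scoped NNReal ENNReal

noncomputable section

universe u v

namespace Paper

/-- The value obtained by choosing the next state `y` depends continuously on `y`. -/
theorem BellmanSolution.continuous_integral
    {X : Type u} [NormedAddCommGroup X] {Ω : Type v} [MeasurableSpace Ω]
    {P : Ω → Measure Ω} {β : ℝ} {u : X → X → Ω → ℝ} {Γ : X → Ω → Set X} {v : X → Ω → ℝ}
    (hv : BellmanSolution P β u Γ v) (ω : Ω) [IsFiniteMeasure (P ω)] :
    Continuous fun y => ∫ ω', v y ω' ∂(P ω) := by
  obtain ⟨⟨M, hM⟩, hcont, hmeas, -⟩ := hv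
  exact continuous_of_dominated (bound := fun _ => M)
    (fun x => (hmeas x).aestronglyMeasurable) (fun x => .of_forall fun ω' => hM x ω')
    (integrable_const M) (.of_forall hcont)

/-- local Lipschitz continuity of the stochastic DP value function
around `x̄` under local Lipschitz continuity of the cost and local lower viability
of the policy multifunction. -/
theorem value_function_locally_lipschitz
    {X : Type u} [NormedAddCommGroup X] [NormedSpace ℝ X] [CompleteSpace X]
    [TopologicalSpace.SeparableSpace X] [MeasurableSpace X] [BorelSpace X]
    {Ω : Type v} [MeasurableSpace Ω]
    (P : Ω → Measure Ω) (β : ℝ) (u : X → X → Ω → ℝ) (Γ : X → Ω → Set X)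
    (hDP : DPStandingAssumptions P β u Γ)
    (v : X → Ω → ℝ) (hv : BellmanSolution P β u Γ v)
    (xbar : X) (l : Ω → ℝ)
    (hG : ∀ ω, (policyMap P β u Γ v xbar ω).Nonempty)
    (hLip : ∃ δ > (0 : ℝ), ∀ ω, ∀ x ∈ ball xbar δ, ∀ y ∈ policyMap P β u Γ v x ω,
      ∃ ε > (0 : ℝ), ∀ p ∈ ball ((xbar, y) : X × X) ε, ∀ q ∈ ball ((xbar, y) : X × X) ε,
        |u p.1 p.2 ω - u q.1 q.2 ω| ≤ l ω * ‖p - q‖)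
    (hviable : LocLowerViable (policyMap P β u Γ v) Γ xbar) :
    ∀ ω, ∃ ε > (0 : ℝ), ∀ x ∈ ball xbar ε, ∀ x' ∈ ball xbar ε,
      |v x ω - v x' ω| ≤ l ω * ‖x - x'‖ := by
  intro ω
  obtain ⟨⟨hprob, -⟩, -, -, -, hu, -, hΓ, -, hΓsc, -⟩ := hDP
  have := hprob ω
  have hint := hv.continuous_integral ω
  obtain ⟨-, hvcont, -, hbell⟩ := hv
  obtain ⟨δ, hδ, hLip⟩ := hLip
  obtain ⟨U, hU, hviable⟩ := hviable ω
  have hlocal : ∀ y ∈ Γ xbar ω, ∀ᶠ p : (X × X) × X in 𝓝 (xbar, xbar) ×ˢ 𝓝 y,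
      p.2 ∈ policyMap P β u Γ v p.1.1 ω →
        |u p.1.1 p.2 ω - u p.1.2 p.2 ω| ≤ l ω * ‖p.1.1 - p.1.2‖ := by
    intro y hy
    rw [← nhds_prod_eq]
    by_cases hyG : y ∈ policyMap P β u Γ v xbar ω
    · obtain ⟨ε, hε, hLipy⟩ := hLip ω xbar (mem_ball_self hδ) y hyG
      have h₁ : ContinuousAt (fun p : (X × X) × X => (p.1.1, p.2)) ((xbar, xbar), y) := by
        fun_prop
      have h₂ : ContinuousAt (fun p : (X × X) × X => (p.1.2, p.2)) ((xbar, xbar), y) := by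
        fun_prop
      filter_upwards [h₁ (ball_mem_nhds _ hε), h₂ (ball_mem_nhds _ hε)] with p hp hp' _
      simpa [Prod.norm_def] using hLipy _ hp _ hp'
    · have hne : v xbar ω ≠ u xbar y ω + β * ∫ ω', v y ω' ∂(P ω) := fun h => hyG ⟨hy, h⟩
      have hl : Continuous fun p : (X × X) × X => v p.1.1 ω :=
        (hvcont ω).comp (by fun_prop)
      have hr : Continuous fun p : (X × X) × X =>
          u p.1.1 p.2 ω + β * ∫ ω', v p.2 ω' ∂(P ω) :=
        ((hu ω).comp (f := fun p : (X × X) × X => (p.1.1, p.2)) (by fun_prop)).add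
          (continuous_const.mul (hint.comp continuous_snd))
      filter_upwards [(isOpen_ne_fun hl hr).mem_nhds (x := ((xbar, xbar), y)) hne]
        with p hp hpG
      exact absurd hpG.2 hp
  have htube := (hΓ xbar ω).2.mem_prod_nhdsSet_of_forall hlocal
  obtain ⟨A, hA, B, hB, hAB⟩ := mem_prod_iff.1 htube
  obtain ⟨V, hVo, hKV, hVB⟩ := mem_nhdsSet_iff_exists.1 hB
  have hΓV : ∀ᶠ x in 𝓝 xbar, Γ x ω ⊆ V := ((hΓsc ω).2 V hVo).mem_nhds hKV
  rw [nhds_prod_eq] at hA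
  obtain ⟨W, hW, hWA⟩ := mem_prod_same_iff.1 hA
  obtain ⟨ε, hε, hball⟩ := Metric.mem_nhds_iff.1 (inter_mem (inter_mem hU hW) hΓV)
  have key : ∀ x ∈ ball xbar ε, ∀ x' ∈ ball xbar ε, v x' ω - v x ω ≤ l ω * ‖x - x'‖ := by
    intro x hx x' hx'
    obtain ⟨⟨hxU, hxW⟩, hxV⟩ := hball hx
    obtain ⟨⟨hxU', hxW'⟩, -⟩ := hball hx'
    obtain ⟨y, hyG, hyΓ⟩ := hviable x hxU x' hxU'
    have hlip : |u x y ω - u x' y ω| ≤ l ω * ‖x - x'‖ :=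
      hAB (show ((x, x'), y) ∈ A ×ˢ B from ⟨hWA ⟨hxW, hxW'⟩, hVB (hxV hyG.1)⟩) hyG
    have hle := (hbell x' ω).2 y hyΓ
    have heq := hyG.2
    linarith [neg_abs_le (u x y ω - u x' y ω)]
  refine ⟨ε, hε, fun x hx x' hx' => abs_sub_le_iff.2 ⟨?_, key x hx x' hx'⟩⟩
  rw [norm_sub_rev]
  exact key x' hx' x hx

end Paper
end
end
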